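/- Let k ≥ 1 be an integer and w a real number; set α = 1/(k+1) and for a real x and m ∈ ℕ let (x)_m = ∏_{j=0}^{m-1}(x-j) denote the falling factorial. Define u_{k,w}(z) = z·e^z·Σ_{m=0}^∞ (wk/(k+1)²)^m · z^{(k+1)m}/(m!·(m+α)_m) − e^z·Σ_{m=0}^∞ (wk/(k+1)²)^m · z^{(k+1)m}/(m!·(m−α)_m). Then both series converge for every real z, u_{k,w}(0) = -1, u_{k,w}'(0) = 0, and u_{k,w} satisfies the differential equation u''(z) − 2u'(z) + (1 − w k z^{k-1})·u(z) = 0 for every real z. -/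

import Mathlib

open scoped BigOperators

/-- The falling factorial `(x)_m = x (x-1) ⋯ (x-m+1)` of a real number. -/
noncomputable def fallFact (x : ℝ) (m : ℕ) : ℝ := ∏ j ∈ Finset.range m, (x - j)

/-- The function `u_{k,w}` given by the Bessel-type series. -/
noncomputable def ukw (k : ℕ) (w : ℝ) (z : ℝ) : ℝ :=
  z * Real.exp z * ∑' m : ℕ, (w * k / ((k : ℝ) + 1) ^ 2) ^ m * z ^ ((k + 1) * m) /
      ((Nat.factorial m : ℝ) * fallFact ((m : ℝ) + 1 / ((k : ℝ) + 1)) m)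
    - Real.exp z * ∑' m : ℕ, (w * k / ((k : ℝ) + 1) ^ 2) ^ m * z ^ ((k + 1) * m) /
      ((Nat.factorial m : ℝ) * fallFact ((m : ℝ) - 1 / ((k : ℝ) + 1)) m)

open Filter Topology

/-- The formal derivative of a sequence of power series coefficients. -/
def coeffDeriv (p : ℕ → ℝ) (m : ℕ) : ℝ := ((m : ℝ) + 1) * p (m + 1)

theorem summable_norm_natCast_mul_pow {p : ℕ → ℝ}
    (hp : ∀ r : ℝ, Summable fun m => p m * r ^ m) {R : ℝ} (hR : 1 ≤ R) :
    Summable fun m : ℕ => ‖p m‖ * (m * R ^ (m - 1)) := by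
  refine Summable.of_nonneg_of_le (fun m => by positivity) (fun m => ?_) (hp (2 * R)).norm
  rw [norm_mul, Real.norm_of_nonneg (by positivity : (0 : ℝ) ≤ (2 * R) ^ m), mul_pow]
  have h₂ : (m : ℝ) ≤ 2 ^ m := by exact_mod_cast Nat.lt_two_pow_self.le
  have h₃ : R ^ (m - 1) ≤ R ^ m := pow_le_pow_right₀ hR (Nat.sub_le m 1)
  gcongr

theorem summable_coeffDeriv {p : ℕ → ℝ} (hp : ∀ r : ℝ, Summable fun m => p m * r ^ m) (r : ℝ) :
    Summable fun m => coeffDeriv p m * r ^ m := by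
  have h := (summable_nat_add_iff 1).2
    (summable_norm_natCast_mul_pow hp (R := 1 + |r|) (by linarith [abs_nonneg r]))
  refine Summable.of_norm_bounded h fun m => ?_
  have h₁ : |r| ^ m ≤ (1 + |r|) ^ m := pow_le_pow_left₀ (abs_nonneg r) (by linarith) m
  rw [coeffDeriv, norm_mul, norm_mul, norm_pow, Real.norm_eq_abs r,
    Real.norm_of_nonneg (by positivity : (0 : ℝ) ≤ (m : ℝ) + 1), Nat.add_sub_cancel]
  push_cast
  calc ((m : ℝ) + 1) * ‖p (m + 1)‖ * |r| ^ m
      ≤ ((m : ℝ) + 1) * ‖p (m + 1)‖ * (1 + |r|) ^ m := by gcongr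
    _ = _ := by ring

theorem hasDerivAt_tsum_mul_pow {p : ℕ → ℝ} (hp : ∀ r : ℝ, Summable fun m => p m * r ^ m)
    (y : ℝ) :
    HasDerivAt (fun y => ∑' m, p m * y ^ m) (∑' m, coeffDeriv p m * y ^ m) y := by
  have hs := summable_norm_natCast_mul_pow hp (R := 1 + |y|) (by linarith [abs_nonneg y])
  have hbound : ∀ (m : ℕ) (x : ℝ), x ∈ Metric.ball (0 : ℝ) (1 + |y|) →
      ‖p m * (m * x ^ (m - 1))‖ ≤ ‖p m‖ * (m * (1 + |y|) ^ (m - 1)) := by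
    intro m x hx
    have hx' : |x| ≤ 1 + |y| := by
      have := mem_ball_zero_iff.1 hx
      rw [Real.norm_eq_abs] at this
      exact this.le
    rw [norm_mul, norm_mul, norm_pow, Real.norm_eq_abs x, Real.norm_natCast]
    gcongr
  have hy : y ∈ Metric.ball (0 : ℝ) (1 + |y|) := by simp
  have key := hasDerivAt_tsum_of_isPreconnected hs Metric.isOpen_ball
    (convex_ball (0 : ℝ) (1 + |y|)).isPreconnected
    (fun m x _ => (hasDerivAt_pow m x).const_mul (p m)) hbound hy (hp y) hy
  refine key.congr_deriv ?_
  rw [(Summable.of_norm_bounded hs fun m => hbound m y hy).tsum_eq_zero_add]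
  simp only [Nat.cast_zero, zero_mul, mul_zero, zero_add, coeffDeriv, Nat.add_sub_cancel]
  refine tsum_congr fun m => ?_
  push_cast
  ring

theorem mul_tsum_coeffDeriv_add {p : ℕ → ℝ} (hp : ∀ r : ℝ, Summable fun m => p m * r ^ m)
    {β c : ℝ} (hrec : ∀ m : ℕ, ((m : ℝ) + 1) * (m + 1 + β) * p (m + 1) = c * p m) (y : ℝ) :
    y * ∑' m, coeffDeriv (coeffDeriv p) m * y ^ m + (1 + β) * ∑' m, coeffDeriv p m * y ^ m
      = c * ∑' m, p m * y ^ m := by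
  have h₁ := summable_coeffDeriv hp
  have h₂ := summable_coeffDeriv h₁
  have hshift : (fun m : ℕ => y * (coeffDeriv (coeffDeriv p) m * y ^ m)) =
      fun m : ℕ => ((m + 1 : ℕ) : ℝ) * coeffDeriv p (m + 1) * y ^ (m + 1) := by
    funext m
    rw [coeffDeriv]
    push_cast
    ring
  have hs : Summable fun m : ℕ => (m : ℝ) * coeffDeriv p m * y ^ m := by
    refine (summable_nat_add_iff 1).1 ?_
    rw [← hshift]
    exact (h₂ y).mul_left y
  have e : y * ∑' m, coeffDeriv (coeffDeriv p) m * y ^ m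
      = ∑' m : ℕ, (m : ℝ) * coeffDeriv p m * y ^ m := by
    rw [← tsum_mul_left, hshift, hs.tsum_eq_zero_add]
    simp
  rw [e, ← tsum_mul_left, ← tsum_mul_left, ← hs.tsum_add ((h₁ y).mul_left _)]
  refine tsum_congr fun m => ?_
  rw [coeffDeriv]
  linear_combination y ^ m * hrec m

theorem fallFact_add_one_succ (x : ℝ) (m : ℕ) :
    fallFact (x + 1) (m + 1) = (x + 1) * fallFact x m := by
  rw [fallFact, Finset.prod_range_succ', fallFact, mul_comm]
  congr 1
  · simp
  · refine Finset.prod_congr rfl fun j _ => ?_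
    push_cast
    ring

theorem fallFact_natCast_add_pos {β : ℝ} (hβ : -1 < β) (m : ℕ) :
    0 < fallFact ((m : ℝ) + β) m := by
  refine Finset.prod_pos fun j hj => ?_
  have : (j : ℝ) + 1 ≤ m := by exact_mod_cast Finset.mem_range.1 hj
  linarith

/-- The coefficients `c ^ m / (m! (m + β)_m)` of a Bessel-type series. -/
noncomputable def besselCoeff (c β : ℝ) (m : ℕ) : ℝ :=
  c ^ m / ((Nat.factorial m : ℝ) * fallFact ((m : ℝ) + β) m)

theorem tsum_besselCoeff_mul_zero_pow (c β : ℝ) :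
    ∑' m, besselCoeff c β m * (0 : ℝ) ^ m = 1 := by
  rw [tsum_eq_single 0 fun m hm => by simp [hm]]
  simp [besselCoeff, fallFact]

theorem besselCoeff_succ {β : ℝ} (hβ : -1 < β) (c : ℝ) (m : ℕ) :
    ((m : ℝ) + 1) * (m + 1 + β) * besselCoeff c β (m + 1) = c * besselCoeff c β m := by
  have h := fallFact_natCast_add_pos hβ m
  have hm : (m : ℝ) + β + 1 ≠ 0 := by have : (0 : ℝ) ≤ m := m.cast_nonneg; linarith
  have hf : (Nat.factorial m : ℝ) ≠ 0 := by positivity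
  have hm' : (m : ℝ) + 1 ≠ 0 := by positivity
  have e : ((m + 1 : ℕ) : ℝ) + β = (m : ℝ) + β + 1 := by push_cast; ring
  rw [besselCoeff, besselCoeff, e, fallFact_add_one_succ, Nat.factorial_succ]
  push_cast
  have h' := h.ne'
  field_simp
  ring

theorem summable_besselCoeff {β : ℝ} (hβ : -1 < β) (c r : ℝ) :
    Summable fun m => besselCoeff c β m * r ^ m := by
  refine summable_of_ratio_norm_eventually_le (r := 1 / 2) (by norm_num) ?_
  have hev : ∀ᶠ m : ℕ in atTop, 2 * |c * r| / (1 + β) ≤ m :=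
    tendsto_natCast_atTop_atTop.eventually_ge_atTop _
  filter_upwards [hev] with m hm
  have hβ' : 0 < 1 + β := by linarith
  rw [div_le_iff₀ hβ'] at hm
  have hm0 : (0 : ℝ) ≤ m := m.cast_nonneg
  have hD : 0 < ((m : ℝ) + 1) * (m + 1 + β) := mul_pos (by linarith) (by linarith)
  have hDle : 2 * |c * r| ≤ ((m : ℝ) + 1) * (m + 1 + β) := by nlinarith
  have e : ((m : ℝ) + 1) * (m + 1 + β) * (besselCoeff c β (m + 1) * r ^ (m + 1))
      = c * r * (besselCoeff c β m * r ^ m) := by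
    linear_combination r ^ (m + 1) * besselCoeff_succ hβ c m
  have e' := congrArg norm e
  rw [norm_mul, norm_mul (c * r), Real.norm_of_nonneg hD.le, Real.norm_eq_abs (c * r)] at e'
  refine le_of_mul_le_mul_left ?_ hD
  rw [e']
  nlinarith [norm_nonneg (besselCoeff c β m * r ^ m)]

theorem ukw_eq (k : ℕ) (w z : ℝ) :
    ukw k w z = z * Real.exp z *
        ∑' m, besselCoeff (w * k / ((k : ℝ) + 1) ^ 2) (1 / ((k : ℝ) + 1)) m * (z ^ (k + 1)) ^ m
      - Real.exp z *
        ∑' m, besselCoeff (w * k / ((k : ℝ) + 1) ^ 2) (-(1 / ((k : ℝ) + 1))) m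
          * (z ^ (k + 1)) ^ m := by
  simp only [ukw, besselCoeff, pow_mul, sub_eq_add_neg, div_mul_eq_mul_div]

/-- If `P` and `Q` solve the equations `y f'' + (1 ± a) f' = c f`, then
`e ^ z (z P (z ^ (n + 2)) - Q (z ^ (n + 2)))` solves the linearised Riccati equation. -/
theorem exp_mul_bessel_ode {P P₁ P₂ Q Q₁ Q₂ u : ℝ → ℝ} {a c w : ℝ} (n : ℕ)
    (hcK : c * (((n + 1 : ℕ) : ℝ) + 1) ^ 2 = w * ((n + 1 : ℕ) : ℝ))
    (haK : a * (((n + 1 : ℕ) : ℝ) + 1) = 1)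
    (hP : ∀ y, HasDerivAt P (P₁ y) y) (hP' : ∀ y, HasDerivAt P₁ (P₂ y) y)
    (hQ : ∀ y, HasDerivAt Q (Q₁ y) y) (hQ' : ∀ y, HasDerivAt Q₁ (Q₂ y) y)
    (hode₁ : ∀ y, y * P₂ y + (1 + a) * P₁ y = c * P y)
    (hode₂ : ∀ y, y * Q₂ y + (1 + -a) * Q₁ y = c * Q y)
    (hP0 : P 0 = 1) (hQ0 : Q 0 = 1)
    (hu : u = fun z => z * Real.exp z * P (z ^ (n + 1 + 1)) - Real.exp z * Q (z ^ (n + 1 + 1))) :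
    u 0 = -1 ∧ deriv u 0 = 0 ∧
    ∀ z : ℝ, deriv (deriv u) z - 2 * deriv u z
        + (1 - w * ((n + 1 : ℕ) : ℝ) * z ^ (n + 1 - 1)) * u z = 0 := by
  have hpow : ∀ z : ℝ, HasDerivAt (fun z : ℝ => z ^ (n + 1 + 1))
      (((n + 1 + 1 : ℕ) : ℝ) * z ^ (n + 1)) z := fun z => hasDerivAt_pow (n + 1 + 1) z
  have hpow' : ∀ z : ℝ, HasDerivAt (fun z : ℝ => z ^ (n + 1))
      (((n + 1 : ℕ) : ℝ) * z ^ n) z := fun z => hasDerivAt_pow (n + 1) z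
  have hcomp : ∀ {f f' : ℝ → ℝ}, (∀ y, HasDerivAt f (f' y) y) → ∀ z : ℝ,
      HasDerivAt (fun z => f (z ^ (n + 1 + 1)))
        (f' (z ^ (n + 1 + 1)) * (((n + 1 + 1 : ℕ) : ℝ) * z ^ (n + 1))) z :=
    fun {f _} hf z => HasDerivAt.comp (h₂ := f) z (hf _) (hpow z)
  have hPz := hcomp hP
  have hPz' := hcomp hP'
  have hQz := hcomp hQ
  have hQz' := hcomp hQ'
  have hexp := Real.hasDerivAt_exp
  have hd : deriv u = fun z => Real.exp z *
      (P (z ^ (n + 1 + 1)) + z * P (z ^ (n + 1 + 1)) - Q (z ^ (n + 1 + 1))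
        + ((n + 1 + 1 : ℕ) : ℝ) * (z * z ^ (n + 1) * P₁ (z ^ (n + 1 + 1))
          - z ^ (n + 1) * Q₁ (z ^ (n + 1 + 1)))) := by
    funext z
    rw [hu]
    refine ((((hasDerivAt_id z).mul (hexp z)).mul (hPz z)).sub
      ((hexp z).mul (hQz z))).deriv.trans ?_
    simp only [Pi.mul_apply, id]
    ring
  have hdd : ∀ z, HasDerivAt (deriv u) _ z := fun z => by
    rw [hd]
    exact (hexp z).mul (((((hPz z).add ((hasDerivAt_id z).mul (hPz z))).sub (hQz z)).add
      (((((hasDerivAt_id z).mul (hpow' z)).mul (hPz' z)).sub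
        ((hpow' z).mul (hQz' z))).const_mul _)))
  refine ⟨?_, ?_, fun z => ?_⟩
  · rw [hu]
    simp [hQ0]
  · rw [hd]
    simp [hP0, hQ0]
  · rw [(hdd z).deriv, hd, hu]
    simp only [Pi.mul_apply, id, Nat.add_sub_cancel]
    have h₁ := hode₁ (z ^ (n + 1 + 1))
    have h₂ := hode₂ (z ^ (n + 1 + 1))
    generalize P (z ^ (n + 1 + 1)) = p at *
    generalize P₁ (z ^ (n + 1 + 1)) = p₁ at *
    generalize P₂ (z ^ (n + 1 + 1)) = p₂ at *
    generalize Q (z ^ (n + 1 + 1)) = q at *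
    generalize Q₁ (z ^ (n + 1 + 1)) = q₁ at *
    generalize Q₂ (z ^ (n + 1 + 1)) = q₂ at *
    rw [← hcK]
    push_cast at haK ⊢
    linear_combination Real.exp z * z ^ n * ((n : ℝ) + 1 + 1) ^ 2 * (z * h₁ - h₂)
      - Real.exp z * z ^ n * ((n : ℝ) + 1 + 1) * (z * p₁ + q₁) * haK

/-- Both series defining `u_{k,w}` converge for every real `z`, and `u_{k,w}`
satisfies `u(0) = -1`, `u'(0) = 0` and the ODE `u'' - 2u' + (1 - w k z^(k-1)) u = 0`. -/
theorem stmt8 (k : ℕ) (hk : 1 ≤ k) (w : ℝ) :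
    (∀ z : ℝ, Summable (fun m : ℕ => (w * k / ((k : ℝ) + 1) ^ 2) ^ m * z ^ ((k + 1) * m) /
        ((Nat.factorial m : ℝ) * fallFact ((m : ℝ) + 1 / ((k : ℝ) + 1)) m)) ∧
      Summable (fun m : ℕ => (w * k / ((k : ℝ) + 1) ^ 2) ^ m * z ^ ((k + 1) * m) /
        ((Nat.factorial m : ℝ) * fallFact ((m : ℝ) - 1 / ((k : ℝ) + 1)) m))) ∧
    ukw k w 0 = -1 ∧ deriv (ukw k w) 0 = 0 ∧
    ∀ z : ℝ, deriv (deriv (ukw k w)) z - 2 * deriv (ukw k w) z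
        + (1 - w * k * z ^ (k - 1)) * ukw k w z = 0 := by
  have hα : -1 < 1 / ((k : ℝ) + 1) :=
    lt_trans (by norm_num) (by positivity : (0 : ℝ) < 1 / ((k : ℝ) + 1))
  have hα' : -1 < -(1 / ((k : ℝ) + 1)) := by
    have hk' : (1 : ℝ) ≤ k := by exact_mod_cast hk
    rw [neg_lt_neg_iff, div_lt_one (by positivity)]
    linarith
  obtain ⟨n, rfl⟩ : ∃ n, k = n + 1 := ⟨k - 1, by omega⟩
  have hcK : w * ((n + 1 : ℕ) : ℝ) / (((n + 1 : ℕ) : ℝ) + 1) ^ 2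
      * (((n + 1 : ℕ) : ℝ) + 1) ^ 2 = w * ((n + 1 : ℕ) : ℝ) := by field_simp
  have haK : 1 / (((n + 1 : ℕ) : ℝ) + 1) * (((n + 1 : ℕ) : ℝ) + 1) = 1 := by field_simp
  refine ⟨fun z => ⟨?_, ?_⟩, ?_⟩
  · simpa only [besselCoeff, pow_mul, div_mul_eq_mul_div] using
      summable_besselCoeff hα (w * ((n + 1 : ℕ) : ℝ) / (((n + 1 : ℕ) : ℝ) + 1) ^ 2)
        (z ^ (n + 1 + 1))
  · simpa only [besselCoeff, pow_mul, sub_eq_add_neg, div_mul_eq_mul_div] using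
      summable_besselCoeff hα' (w * ((n + 1 : ℕ) : ℝ) / (((n + 1 : ℕ) : ℝ) + 1) ^ 2)
        (z ^ (n + 1 + 1))
  have hp := summable_besselCoeff hα (w * ((n + 1 : ℕ) : ℝ) / (((n + 1 : ℕ) : ℝ) + 1) ^ 2)
  have hq := summable_besselCoeff hα' (w * ((n + 1 : ℕ) : ℝ) / (((n + 1 : ℕ) : ℝ) + 1) ^ 2)
  exact exp_mul_bessel_ode n hcK haK
    (hasDerivAt_tsum_mul_pow hp) (hasDerivAt_tsum_mul_pow (summable_coeffDeriv hp))
    (hasDerivAt_tsum_mul_pow hq) (hasDerivAt_tsum_mul_pow (summable_coeffDeriv hq))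
    (mul_tsum_coeffDeriv_add hp (besselCoeff_succ hα _))
    (mul_tsum_coeffDeriv_add hq (besselCoeff_succ hα' _))
    (tsum_besselCoeff_mul_zero_pow _ _) (tsum_besselCoeff_mul_zero_pow _ _)
    (funext (ukw_eq (n + 1) w))
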